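/- arXiv:1710.08368 — 6 statements merged into one kernel-verified Lean document; each statement's English description precedes it below -/
import Mathlib

section
/- Let γ > 1 and let A : [0,∞) → M₃(ℝ) be a twice continuously differentiable matrix-valued map with det A(t) > 0 for all t ≥ 0 that satisfies the affine ODE A''(t) = (det A(t))^{1−γ} (A(t)⁻¹)ᵀ for all t ≥ 0. Then the energy E(t) := (1/2)‖A'(t)‖² + (γ−1)⁻¹ (det A(t))^{1−γ} is constant in t. Consequently ‖A'(t)‖ ≤ √(2E(0)) for all t ≥ 0, and ‖A(t)‖ ≤ ‖A(0)‖ + t·√(2E(0)) for all t ≥ 0. -/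
open Matrix Filter Set

attribute [local instance] Matrix.frobeniusNormedAddCommGroup Matrix.frobeniusNormedSpace

/-- The conserved energy of the Sideris affine ODE:
`E(t) = (1/2)‖A'(t)‖² + (γ−1)⁻¹ (det A(t))^{1−γ}`, with `‖·‖` the Frobenius norm. -/
noncomputable def affineEnergy (γ : ℝ) (A A' : ℝ → Matrix (Fin 3) (Fin 3) ℝ) (t : ℝ) : ℝ :=
  (1 / 2) * ‖A' t‖ ^ 2 + (γ - 1)⁻¹ * (A t).det ^ (1 - γ)

theorem frobenius_norm_sq_eq_sum {m n : Type*} [Fintype m] [Fintype n] (M : Matrix m n ℝ) :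
    ‖M‖ ^ 2 = ∑ i, ∑ j, M i j ^ 2 := by
  rw [Matrix.frobenius_norm_def, ← Real.sqrt_eq_rpow, Real.sq_sqrt (by positivity)]
  simp

theorem hasDerivWithinAt_matrix_apply {m n : Type*} [Fintype m] [Fintype n]
    {A : ℝ → Matrix m n ℝ} {B : Matrix m n ℝ} {s : Set ℝ} {t : ℝ}
    (h : HasDerivWithinAt A B s t) (i : m) (j : n) :
    HasDerivWithinAt (fun u => A u i j) (B i j) s t :=
  (Matrix.entryLinearMap ℝ ℝ i j).toContinuousLinearMap.hasFDerivAt.comp_hasDerivWithinAt t h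

/-- Jacobi's formula for the derivative of a `3 × 3` determinant. -/
theorem hasDerivWithinAt_det_fin_three {A : ℝ → Matrix (Fin 3) (Fin 3) ℝ}
    {B : Matrix (Fin 3) (Fin 3) ℝ} {s : Set ℝ} {t : ℝ} (h : HasDerivWithinAt A B s t) :
    HasDerivWithinAt (fun u => (A u).det) (∑ i, ∑ j, B i j * (A t).adjugate j i) s t := by
  have e := hasDerivWithinAt_matrix_apply h
  simp only [Matrix.det_fin_three]
  refine ((((((((e 0 0).mul (e 1 1)).mul (e 2 2)).sub
    (((e 0 0).mul (e 1 2)).mul (e 2 1))).sub (((e 0 1).mul (e 1 0)).mul (e 2 2))).add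
    (((e 0 1).mul (e 1 2)).mul (e 2 0))).add (((e 0 2).mul (e 1 0)).mul (e 2 1))).sub
    (((e 0 2).mul (e 1 1)).mul (e 2 0))).congr_deriv ?_
  simp [Matrix.adjugate_fin_three, Fin.sum_univ_three]
  ring

theorem hasDerivWithinAt_frobenius_norm_sq {m n : Type*} [Fintype m] [Fintype n]
    {A : ℝ → Matrix m n ℝ} {B : Matrix m n ℝ} {s : Set ℝ} {t : ℝ}
    (h : HasDerivWithinAt A B s t) :
    HasDerivWithinAt (fun u => ‖A u‖ ^ 2) (∑ i, ∑ j, 2 * (A t i j * B i j)) s t := by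
  simp only [frobenius_norm_sq_eq_sum]
  refine HasDerivWithinAt.fun_sum fun i _ => HasDerivWithinAt.fun_sum fun j _ => ?_
  refine ((hasDerivWithinAt_matrix_apply h i j).fun_pow 2).congr_deriv ?_
  simp [mul_assoc]

theorem hasDerivWithinAt_affineEnergy {γ : ℝ} (hγ : γ ≠ 1)
    {A A' : ℝ → Matrix (Fin 3) (Fin 3) ℝ} {s : Set ℝ} {t : ℝ}
    (hA : HasDerivWithinAt A (A' t) s t)
    (hA' : HasDerivWithinAt A' (((A t).det ^ (1 - γ)) • ((A t)⁻¹)ᵀ) s t)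
    (hdet : 0 < (A t).det) :
    HasDerivWithinAt (affineEnergy γ A A') 0 s t := by
  have h := ((hasDerivWithinAt_frobenius_norm_sq hA').const_mul (1 / 2)).add
    (((hasDerivWithinAt_det_fin_three hA).rpow_const (p := 1 - γ)
      (Or.inl hdet.ne')).const_mul (γ - 1)⁻¹)
  refine h.congr_deriv ?_
  have hγ' : γ - 1 ≠ 0 := sub_ne_zero.mpr hγ
  have hd := hdet.ne'
  rw [Real.rpow_sub_one hd]
  simp only [Matrix.smul_apply, Matrix.transpose_apply, Matrix.inv_def, Ring.inverse_eq_inv',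
    smul_eq_mul, Fin.sum_univ_three]
  field_simp
  ring

/-- Energy conservation for the affine ODE `A'' = (det A)^{1−γ} (A⁻¹)ᵀ`, and the resulting
linear growth bounds on `A'` and `A`. -/
theorem stmt0 (γ : ℝ) (hγ : 1 < γ)
    (A A' A'' : ℝ → Matrix (Fin 3) (Fin 3) ℝ)
    (hA : ∀ t ∈ Ici (0 : ℝ), HasDerivWithinAt A (A' t) (Ici 0) t)
    (hA' : ∀ t ∈ Ici (0 : ℝ), HasDerivWithinAt A' (A'' t) (Ici 0) t)
    (hA'' : ContinuousOn A'' (Ici 0))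
    (hdet : ∀ t ∈ Ici (0 : ℝ), 0 < (A t).det)
    (hode : ∀ t ∈ Ici (0 : ℝ), A'' t = ((A t).det ^ (1 - γ)) • ((A t)⁻¹)ᵀ) :
    (∀ t ∈ Ici (0 : ℝ), affineEnergy γ A A' t = affineEnergy γ A A' 0) ∧
    (∀ t ∈ Ici (0 : ℝ), ‖A' t‖ ≤ Real.sqrt (2 * affineEnergy γ A A' 0)) ∧
    (∀ t ∈ Ici (0 : ℝ), ‖A t‖ ≤ ‖A 0‖ + t * Real.sqrt (2 * affineEnergy γ A A' 0)) := by
  have hE : ∀ t ∈ Ici (0 : ℝ), HasDerivWithinAt (affineEnergy γ A A') 0 (Ici 0) t := fun t ht =>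
    hasDerivWithinAt_affineEnergy hγ.ne' (hA t ht) (hode t ht ▸ hA' t ht) (hdet t ht)
  have hconst : ∀ t ∈ Ici (0 : ℝ), affineEnergy γ A A' t = affineEnergy γ A A' 0 := fun t ht =>
    constant_of_has_deriv_right_zero
      (fun x hx => (hE x hx.1).continuousWithinAt.mono Icc_subset_Ici_self)
      (fun x hx => (hE x hx.1).mono (Ici_subset_Ici.mpr hx.1)) t ⟨ht, le_rfl⟩
  have hbound : ∀ t ∈ Ici (0 : ℝ), ‖A' t‖ ≤ Real.sqrt (2 * affineEnergy γ A A' 0) := by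
    intro t ht
    apply Real.le_sqrt_of_sq_le
    have hpot : 0 ≤ (γ - 1)⁻¹ * (A t).det ^ (1 - γ) :=
      mul_nonneg (inv_nonneg.mpr (sub_nonneg.mpr hγ.le)) (Real.rpow_nonneg (hdet t ht).le _)
    rw [← hconst t ht, affineEnergy]
    linarith
  refine ⟨hconst, hbound, fun t ht => ?_⟩
  have hgrowth := norm_image_sub_le_of_norm_deriv_le_segment'
    (fun x hx => (hA x hx.1).mono Icc_subset_Ici_self)
    (fun x hx => hbound x hx.1) t ⟨ht, le_rfl⟩
  have htri := norm_le_norm_add_norm_sub' (A t) (A 0)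
  linarith
end

section
/- Let 1 < γ < 4/3 and let A : [0,∞) → M₃(ℝ) be a twice continuously differentiable matrix-valued map with det A(t) > 0 for all t ≥ 0 that satisfies A''(t) = (det A(t))^{1−γ} (A(t)⁻¹)ᵀ for all t ≥ 0, and assume det A(t) ≥ c(t+1)³ and ‖A(t)‖ ≤ C(t+1) for all t ≥ 0 for some constants c, C > 0. Let A₁ := lim_{t→∞} A'(t) (which exists). Then there is a constant C' > 0 such that ‖A(t) − t·A₁‖ ≤ C'(t+1)^{4−3γ} for all t ≥ 0. -/
open Matrix Filter Set

attribute [local instance] Matrix.frobeniusNormedAddCommGroup Matrix.frobeniusNormedSpace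

/-- A curve whose velocity is bounded by `K (t+1)^(p-1)` with `p ≠ 0` moves by at most the
corresponding primitive. -/
theorem norm_sub_le_of_norm_deriv_le_rpow {E : Type*} [NormedAddCommGroup E] [NormedSpace ℝ E]
    {f f' : ℝ → E} {K p : ℝ} (hp : p ≠ 0)
    (hf : ∀ t ∈ Ici (0 : ℝ), HasDerivWithinAt f (f' t) (Ici 0) t)
    (hf' : ∀ t ∈ Ici (0 : ℝ), ‖f' t‖ ≤ K * (t + 1) ^ (p - 1))
    {s t : ℝ} (hs : 0 ≤ s) (hst : s ≤ t) :
    ‖f t - f s‖ ≤ K / p * ((t + 1) ^ p - (s + 1) ^ p) := by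
  have hB : ∀ x ∈ Ici (0 : ℝ), HasDerivAt (fun x : ℝ => K / p * ((x + 1) ^ p - (s + 1) ^ p))
      (K * (x + 1) ^ (p - 1)) x := by
    intro x hx
    have hx1 : x + 1 ≠ 0 := by linarith [mem_Ici.mp hx]
    have h := ((((hasDerivAt_id x).add_const 1).rpow_const (p := p) (Or.inl hx1)).sub_const
      ((s + 1) ^ p)).const_mul (K / p)
    refine h.congr_deriv ?_
    simp only [id]
    field_simp
  refine image_norm_le_of_norm_deriv_right_le_deriv_boundary' (a := s) (b := t)
    (f := fun x => f x - f s) (f' := f')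
    (B := fun x => K / p * ((x + 1) ^ p - (s + 1) ^ p)) (B' := fun x => K * (x + 1) ^ (p - 1))
    ?_ ?_ (by simp) ?_ ?_ ?_ ⟨hst, le_rfl⟩
  · intro x hx
    exact ((hf x (hs.trans hx.1)).sub_const (f s)).continuousWithinAt.mono
      fun y hy => hs.trans hy.1
  · intro x hx
    exact ((hf x (hs.trans hx.1)).sub_const (f s)).mono fun y hy => (hs.trans hx.1).trans hy
  · intro x hx
    exact (hB x (hs.trans hx.1)).continuousAt.continuousWithinAt
  · intro x hx
    exact (hB x (hs.trans hx.1)).hasDerivWithinAt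
  · intro x hx
    exact hf' x (hs.trans hx.1)

/-- The transposed adjugate of a `3 × 3` matrix is bounded quadratically in the matrix. -/
theorem exists_norm_adjugate_transpose_le : ∃ M > (0 : ℝ), ∀ (r : ℝ)
    (B : Matrix (Fin 3) (Fin 3) ℝ), 0 < r → ‖B‖ ≤ r → ‖B.adjugateᵀ‖ ≤ M * r ^ 2 := by
  have hcont : Continuous fun B : Matrix (Fin 3) (Fin 3) ℝ => B.adjugateᵀ :=
    (Continuous.matrix_adjugate continuous_id).matrix_transpose
  have : ProperSpace (Matrix (Fin 3) (Fin 3) ℝ) := FiniteDimensional.proper_real _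
  obtain ⟨M, hM⟩ := (isCompact_closedBall (0 : Matrix (Fin 3) (Fin 3) ℝ)
    1).exists_bound_of_continuousOn hcont.continuousOn
  refine ⟨max M 1, by positivity, fun r B hr hB => ?_⟩
  have hball : r⁻¹ • B ∈ Metric.closedBall (0 : Matrix (Fin 3) (Fin 3) ℝ) 1 := by
    rw [mem_closedBall_zero_iff, norm_smul, Real.norm_of_nonneg (by positivity),
      inv_mul_le_one₀ hr]
    exact hB
  have hscale : B.adjugateᵀ = r ^ 2 • ((r⁻¹ • B).adjugateᵀ) := by
    conv_lhs => rw [← smul_inv_smul₀ hr.ne' B, Matrix.adjugate_smul]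
    simp
  rw [hscale, norm_smul, Real.norm_of_nonneg (by positivity), mul_comm]
  gcongr
  exact (hM _ hball).trans (le_max_left _ _)

/-- Under the growth bounds, the force term of the affine ODE decays like `(t+1)^(2-3γ)`. -/
theorem exists_norm_force_le {γ c C : ℝ} (hγ : 1 < γ) (hc : 0 < c) (hC : 0 < C) :
    ∃ K > (0 : ℝ), ∀ (x : ℝ) (B : Matrix (Fin 3) (Fin 3) ℝ), 0 < x → c * x ^ 3 ≤ B.det →
      ‖B‖ ≤ C * x → ‖(B.det ^ (1 - γ)) • (B⁻¹)ᵀ‖ ≤ K * x ^ (3 - 3 * γ - 1) := by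
  obtain ⟨M, hM, hadj⟩ := exists_norm_adjugate_transpose_le
  refine ⟨c ^ (-γ) * (M * C ^ 2), by positivity, fun x B hx hdet hB => ?_⟩
  have hpos : 0 < c * x ^ 3 := by positivity
  have hd : 0 < B.det := hpos.trans_le hdet
  have hforce : (B.det ^ (1 - γ)) • (B⁻¹)ᵀ = B.det ^ (-γ) • B.adjugateᵀ := by
    rw [Matrix.inv_def, Ring.inverse_eq_inv', Matrix.transpose_smul, smul_smul]
    congr 1
    rw [← Real.rpow_neg_one, ← Real.rpow_add hd]
    ring_nf
  have hpow : B.det ^ (-γ) ≤ c ^ (-γ) * x ^ (-(3 * γ)) := by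
    calc B.det ^ (-γ) ≤ (c * x ^ 3) ^ (-γ) :=
          Real.rpow_le_rpow_of_nonpos hpos hdet (by linarith)
      _ = c ^ (-γ) * x ^ (-(3 * γ)) := by
          rw [Real.mul_rpow hc.le (by positivity), ← Real.rpow_natCast x 3, ← Real.rpow_mul hx.le]
          push_cast
          ring_nf
  rw [hforce, norm_smul, Real.norm_of_nonneg (by positivity)]
  calc B.det ^ (-γ) * ‖B.adjugateᵀ‖
      ≤ (c ^ (-γ) * x ^ (-(3 * γ))) * (M * (C * x) ^ 2) := by
        gcongr
        exact hadj _ B (by positivity) hB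
    _ = c ^ (-γ) * (M * C ^ 2) * (x ^ (-(3 * γ)) * x ^ (2 : ℝ)) := by
        rw [Real.rpow_two]
        ring
    _ = c ^ (-γ) * (M * C ^ 2) * x ^ (3 - 3 * γ - 1) := by
        rw [← Real.rpow_add hx]
        ring_nf

/-- For `1 < γ < 4/3` and a solution of the affine ODE with the stated growth bounds,
`‖A(t) − t·A₁‖ ≤ C'(t+1)^{4−3γ}`, where `A₁` is the limit of `A'(t)`. -/
theorem stmt3 (γ : ℝ) (hγ1 : 1 < γ) (hγ2 : γ < 4 / 3) (c C : ℝ) (hc : 0 < c) (hC : 0 < C)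
    (A A' A'' : ℝ → Matrix (Fin 3) (Fin 3) ℝ)
    (hA : ∀ t ∈ Ici (0 : ℝ), HasDerivWithinAt A (A' t) (Ici 0) t)
    (hA' : ∀ t ∈ Ici (0 : ℝ), HasDerivWithinAt A' (A'' t) (Ici 0) t)
    (hA'' : ContinuousOn A'' (Ici 0))
    (hdet : ∀ t ∈ Ici (0 : ℝ), 0 < (A t).det)
    (hode : ∀ t ∈ Ici (0 : ℝ), A'' t = ((A t).det ^ (1 - γ)) • ((A t)⁻¹)ᵀ)
    (hgrow : ∀ t ∈ Ici (0 : ℝ), c * (t + 1) ^ 3 ≤ (A t).det)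
    (hbound : ∀ t ∈ Ici (0 : ℝ), ‖A t‖ ≤ C * (t + 1))
    (A₁ : Matrix (Fin 3) (Fin 3) ℝ) (hA₁ : Tendsto A' atTop (nhds A₁)) :
    ∃ C' > (0 : ℝ), ∀ t ∈ Ici (0 : ℝ), ‖A t - t • A₁‖ ≤ C' * (t + 1) ^ (4 - 3 * γ) := by
  obtain ⟨K, hK, hforce⟩ := exists_norm_force_le hγ1 hc hC
  have hacc : ∀ t ∈ Ici (0 : ℝ), ‖A'' t‖ ≤ K * (t + 1) ^ (3 - 3 * γ - 1) := by
    intro t ht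
    rw [hode t ht]
    exact hforce _ _ (by linarith [mem_Ici.mp ht]) (hgrow t ht) (hbound t ht)
  set L := K / (3 * γ - 3)
  have hL : 0 < L := div_pos hK (by linarith)
  have hvel : ∀ t ∈ Ici (0 : ℝ), ‖A' t - A₁‖ ≤ L * (t + 1) ^ (4 - 3 * γ - 1) := by
    intro t ht
    rw [norm_sub_rev]
    refine le_of_tendsto (hA₁.sub_const (A' t)).norm ?_
    filter_upwards [eventually_ge_atTop t] with s hs
    have ht0 : 0 ≤ t := ht
    have hs1 : 0 ≤ L * (s + 1) ^ (3 - 3 * γ) :=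
      mul_nonneg hL.le (Real.rpow_nonneg (by linarith) _)
    have hsub := norm_sub_le_of_norm_deriv_le_rpow (by linarith) hA' hacc ht0 hs
    have hneg : K / (3 - 3 * γ) = -L := by
      rw [← neg_sub (3 * γ) 3, div_neg]
    rw [hneg] at hsub
    rw [show 4 - 3 * γ - 1 = 3 - 3 * γ by ring]
    linarith
  have hp : 0 < 4 - 3 * γ := by linarith
  refine ⟨‖A 0‖ + L / (4 - 3 * γ), by positivity, fun t ht => ?_⟩
  have ht0 : 0 ≤ t := ht
  have hdiff : ∀ t ∈ Ici (0 : ℝ),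
      HasDerivWithinAt (fun t => A t - t • A₁) (A' t - A₁) (Ici 0) t := by
    intro t ht
    exact ((hA t ht).sub ((hasDerivWithinAt_id t (Ici 0)).smul_const A₁)).congr_deriv
      (by rw [one_smul])
  have hsub := norm_sub_le_of_norm_deriv_le_rpow hp.ne' hdiff hvel le_rfl ht0
  simp only [zero_smul, sub_zero, zero_add, Real.one_rpow] at hsub
  have hone : 1 ≤ (t + 1) ^ (4 - 3 * γ) := Real.one_le_rpow (by linarith) hp.le
  have hLp : 0 < L / (4 - 3 * γ) := by positivity
  calc ‖A t - t • A₁‖ ≤ ‖A 0‖ + ‖A t - t • A₁ - A 0‖ := norm_le_norm_add_norm_sub' _ _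
    _ ≤ ‖A 0‖ * (t + 1) ^ (4 - 3 * γ) + L / (4 - 3 * γ) * (t + 1) ^ (4 - 3 * γ) := by
        nlinarith [norm_nonneg (A 0)]
    _ = (‖A 0‖ + L / (4 - 3 * γ)) * (t + 1) ^ (4 - 3 * γ) := by ring
end

section
/- Let γ = 4/3 and let A : [0,∞) → M₃(ℝ) be a twice continuously differentiable matrix-valued map with det A(t) > 0 for all t ≥ 0 that satisfies A''(t) = (det A(t))^{1−γ} (A(t)⁻¹)ᵀ for all t ≥ 0, and assume det A(t) ≥ c(t+1)³ and ‖A(t)‖ ≤ C(t+1) for all t ≥ 0 for some constants c, C > 0. Let A₁ := lim_{t→∞} A'(t) (which exists). Then there is a constant C' > 0 such that ‖A(t) − t·A₁‖ ≤ C'·log(t+2) for all t ≥ 0. -/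
open Matrix Filter Set

attribute [local instance] Matrix.frobeniusNormedAddCommGroup Matrix.frobeniusNormedSpace

/-- The adjugate is bounded on balls, with the scaling of a homogeneous map of degree `n - 1`. -/
theorem exists_norm_adjugate_le (n : Type*) [Fintype n] [DecidableEq n] :
    ∃ K : ℝ, 0 < K ∧ ∀ (M : ℝ) (A : Matrix n n ℝ), 0 < M → ‖A‖ ≤ M →
      ‖A.adjugate‖ ≤ K * M ^ (Fintype.card n - 1) := by
  have : ProperSpace (Matrix n n ℝ) := FiniteDimensional.proper_real _
  have hcont : Continuous fun A : Matrix n n ℝ => A.adjugate :=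
    Continuous.matrix_adjugate continuous_id
  obtain ⟨K, hK⟩ := (isCompact_closedBall (0 : Matrix n n ℝ) 1).exists_bound_of_continuousOn
    hcont.continuousOn
  refine ⟨max K 1, by positivity, fun M A hM hA => ?_⟩
  have hmem : M⁻¹ • A ∈ Metric.closedBall (0 : Matrix n n ℝ) 1 := by
    rw [mem_closedBall_zero_iff, norm_smul, norm_inv, Real.norm_of_nonneg hM.le,
      inv_mul_le_iff₀ hM, mul_one]
    exact hA
  have hA_eq : A = M • (M⁻¹ • A) := (smul_inv_smul₀ hM.ne' A).symm
  rw [hA_eq, adjugate_smul, norm_smul, norm_pow, Real.norm_of_nonneg hM.le, mul_comm]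
  gcongr
  exact (hK _ hmem).trans (le_max_left _ _)

section Growth

variable {E : Type*} [NormedAddCommGroup E] [NormedSpace ℝ E] {f f' : ℝ → E} {K : ℝ}

/-- A function whose derivative is `O((t + 1)⁻²)` approaches its limit at rate `(t + 1)⁻¹`. -/
theorem norm_sub_le_div_of_tendsto_of_norm_deriv_le
    (hf : ∀ t ∈ Ici (0 : ℝ), HasDerivWithinAt f (f' t) (Ici 0) t)
    (hf' : ∀ t ∈ Ici (0 : ℝ), ‖f' t‖ ≤ K / (t + 1) ^ 2) {l : E}
    (hl : Tendsto f atTop (nhds l)) {t : ℝ} (ht : 0 ≤ t) : ‖l - f t‖ ≤ K / (t + 1) := by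
  have hK : 0 ≤ K := by simpa using (norm_nonneg _).trans (hf' 0 self_mem_Ici)
  refine le_of_tendsto (hl.sub_const (f t)).norm ?_
  filter_upwards [eventually_ge_atTop t] with s hs
  have hB : ∀ x ∈ Icc t s,
      HasDerivAt (fun x => K / (t + 1) - K / (x + 1)) (K / (x + 1) ^ 2) x := by
    intro x hx
    have hx0 : x + 1 ≠ 0 := by linarith [hx.1]
    refine (((hasDerivAt_const x K).div ((hasDerivAt_id' x).add_const 1) hx0).const_sub
      (K / (t + 1))).congr_deriv ?_
    ring
  have key := image_norm_le_of_norm_deriv_right_le_deriv_boundary'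
    (f := fun x => f x - f t) (f' := f') (a := t) (b := s)
    (fun x hx => (((hf x (ht.trans hx.1)).sub_const (f t)).continuousWithinAt).mono
      fun y hy => ht.trans hy.1)
    (fun x hx => ((hf x (ht.trans hx.1)).sub_const (f t)).mono
      (Ici_subset_Ici.2 (ht.trans hx.1)))
    (by simp)
    (fun x hx => (hB x hx).continuousAt.continuousWithinAt)
    (fun x hx => (hB x (Ico_subset_Icc_self hx)).hasDerivWithinAt)
    (fun x hx => hf' x (ht.trans hx.1)) (right_mem_Icc.2 hs)
  refine key.trans (sub_le_self _ ?_)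
  have : 0 ≤ s := ht.trans hs
  positivity

/-- A function whose derivative is `O((t + 1)⁻¹)` grows at most logarithmically. -/
theorem norm_sub_le_mul_log_of_norm_deriv_le
    (hf : ∀ t ∈ Ici (0 : ℝ), HasDerivWithinAt f (f' t) (Ici 0) t)
    (hf' : ∀ t ∈ Ici (0 : ℝ), ‖f' t‖ ≤ K / (t + 1)) {t : ℝ} (ht : 0 ≤ t) :
    ‖f t - f 0‖ ≤ K * Real.log (t + 1) := by
  have hB : ∀ x ∈ Icc 0 t, HasDerivAt (fun x => K * Real.log (x + 1)) (K / (x + 1)) x := by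
    intro x hx
    have hx0 : x + 1 ≠ 0 := by linarith [hx.1]
    refine ((((hasDerivAt_id' x).add_const 1).log hx0).const_mul K).congr_deriv ?_
    ring
  exact image_norm_le_of_norm_deriv_right_le_deriv_boundary'
    (f := fun x => f x - f 0) (f' := f') (a := 0) (b := t)
    (fun x hx => (((hf x hx.1).sub_const (f 0)).continuousWithinAt).mono fun y hy => hy.1)
    (fun x hx => ((hf x hx.1).sub_const (f 0)).mono (Ici_subset_Ici.2 hx.1))
    (by simp)
    (fun x hx => (hB x hx).continuousAt.continuousWithinAt)
    (fun x hx => (hB x (Ico_subset_Icc_self hx)).hasDerivWithinAt)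
    (fun x hx => hf' x hx.1) (right_mem_Icc.2 ht)

end Growth

/-- The force term of the affine ODE with `γ = 4/3` decays quadratically under the growth bounds. -/
theorem exists_norm_det_rpow_smul_inv_transpose_le {c C : ℝ} (hc : 0 < c) (hC : 0 < C) :
    ∃ K : ℝ, 0 < K ∧ ∀ (s : ℝ) (A : Matrix (Fin 3) (Fin 3) ℝ), 0 < s → c * s ^ 3 ≤ A.det →
      ‖A‖ ≤ C * s → ‖(A.det ^ (1 - 4 / 3 : ℝ)) • (A⁻¹)ᵀ‖ ≤ K / s ^ 2 := by
  obtain ⟨K, hK, hadj⟩ := exists_norm_adjugate_le (Fin 3)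
  refine ⟨c ^ (-(1 / 3) : ℝ) * (c⁻¹ * (K * C ^ 2)), by positivity, fun s A hs hdet hA => ?_⟩
  have hcs : 0 < c * s ^ 3 := by positivity
  have hpos : 0 < A.det := hcs.trans_le hdet
  have hadj' : ‖A.adjugate‖ ≤ K * (C * s) ^ 2 := by
    simpa using hadj (C * s) A (by positivity) hA
  have hpow : A.det ^ (1 - 4 / 3 : ℝ) ≤ c ^ (-(1 / 3) : ℝ) * s⁻¹ := by
    rw [show (1 - 4 / 3 : ℝ) = -(1 / 3) by norm_num]
    refine (Real.rpow_le_rpow_of_nonpos hcs hdet (by norm_num)).trans_eq ?_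
    rw [Real.mul_rpow hc.le (by positivity), ← Real.rpow_natCast s 3, ← Real.rpow_mul hs.le,
      ← Real.rpow_neg_one s]
    norm_num
  have hinv : ‖A⁻¹‖ ≤ (c * s ^ 3)⁻¹ * (K * (C * s) ^ 2) := by
    rw [inv_def, norm_smul, Ring.inverse_eq_inv', norm_inv, Real.norm_of_nonneg hpos.le]
    gcongr
  rw [norm_smul, frobenius_norm_transpose, Real.norm_of_nonneg (by positivity)]
  calc A.det ^ (1 - 4 / 3 : ℝ) * ‖A⁻¹‖
      ≤ (c ^ (-(1 / 3) : ℝ) * s⁻¹) * ((c * s ^ 3)⁻¹ * (K * (C * s) ^ 2)) := by gcongr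
    _ = c ^ (-(1 / 3) : ℝ) * (c⁻¹ * (K * C ^ 2)) / s ^ 2 := by
      field_simp

/-- For `γ = 4/3` and a solution of the affine ODE with the stated growth bounds,
`‖A(t) − t·A₁‖ ≤ C'·log(t+2)`, where `A₁` is the limit of `A'(t)`. -/
theorem stmt4 (γ : ℝ) (hγ : γ = 4 / 3) (c C : ℝ) (hc : 0 < c) (hC : 0 < C)
    (A A' A'' : ℝ → Matrix (Fin 3) (Fin 3) ℝ)
    (hA : ∀ t ∈ Ici (0 : ℝ), HasDerivWithinAt A (A' t) (Ici 0) t)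
    (hA' : ∀ t ∈ Ici (0 : ℝ), HasDerivWithinAt A' (A'' t) (Ici 0) t)
    (hA'' : ContinuousOn A'' (Ici 0))
    (hdet : ∀ t ∈ Ici (0 : ℝ), 0 < (A t).det)
    (hode : ∀ t ∈ Ici (0 : ℝ), A'' t = ((A t).det ^ (1 - γ)) • ((A t)⁻¹)ᵀ)
    (hgrow : ∀ t ∈ Ici (0 : ℝ), c * (t + 1) ^ 3 ≤ (A t).det)
    (hbound : ∀ t ∈ Ici (0 : ℝ), ‖A t‖ ≤ C * (t + 1))
    (A₁ : Matrix (Fin 3) (Fin 3) ℝ) (hA₁ : Tendsto A' atTop (nhds A₁)) :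
    ∃ C' > (0 : ℝ), ∀ t ∈ Ici (0 : ℝ), ‖A t - t • A₁‖ ≤ C' * Real.log (t + 2) := by
  subst hγ
  obtain ⟨K, hK, hforce⟩ := exists_norm_det_rpow_smul_inv_transpose_le hc hC
  have hA''_le : ∀ t ∈ Ici (0 : ℝ), ‖A'' t‖ ≤ K / (t + 1) ^ 2 := by
    intro t ht
    have ht0 : (0 : ℝ) ≤ t := ht
    rw [hode t ht]
    exact hforce (t + 1) (A t) (by positivity) (hgrow t ht) (hbound t ht)
  have hA'_le : ∀ t ∈ Ici (0 : ℝ), ‖A' t - A₁‖ ≤ K / (t + 1) := by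
    intro t ht
    rw [norm_sub_rev]
    exact norm_sub_le_div_of_tendsto_of_norm_deriv_le hA' hA''_le hA₁ ht
  have hderiv : ∀ t ∈ Ici (0 : ℝ),
      HasDerivWithinAt (fun t => A t - t • A₁) (A' t - A₁) (Ici 0) t := by
    intro t ht
    exact ((hA t ht).fun_sub ((hasDerivWithinAt_id t (Ici 0)).smul_const A₁)).congr_deriv
      (by rw [one_smul])
  have hlog2 : 0 < Real.log 2 := Real.log_pos one_lt_two
  refine ⟨K + ‖A 0‖ / Real.log 2, by positivity, fun t ht => ?_⟩
  have ht0 : (0 : ℝ) ≤ t := ht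
  have hdiff : ‖(A t - t • A₁) - A 0‖ ≤ K * Real.log (t + 1) := by
    simpa using norm_sub_le_mul_log_of_norm_deriv_le hderiv hA'_le ht0
  have hA0 : ‖A 0‖ ≤ ‖A 0‖ / Real.log 2 * Real.log (t + 2) := by
    rw [div_mul_eq_mul_div, le_div_iff₀ hlog2]
    gcongr
    linarith
  calc ‖A t - t • A₁‖ ≤ ‖(A t - t • A₁) - A 0‖ + ‖A 0‖ := norm_le_norm_sub_add _ _
    _ ≤ K * Real.log (t + 2) + ‖A 0‖ / Real.log 2 * Real.log (t + 2) := by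
      refine add_le_add (hdiff.trans ?_) hA0
      gcongr
      norm_num
    _ = (K + ‖A 0‖ / Real.log 2) * Real.log (t + 2) := by ring
end

section
/- Let γ > 4/3 and let A : [0,∞) → M₃(ℝ) be a twice continuously differentiable matrix-valued map with det A(t) > 0 for all t ≥ 0 that satisfies A''(t) = (det A(t))^{1−γ} (A(t)⁻¹)ᵀ for all t ≥ 0, and assume det A(t) ≥ c(t+1)³ and ‖A(t)‖ ≤ C(t+1) for all t ≥ 0 for some constants c, C > 0. Let A₁ := lim_{t→∞} A'(t) (which exists). Then there exists a unique matrix A₀ ∈ M₃(ℝ) and a constant C' > 0 such that ‖A(t) − (t·A₁ + A₀)‖ ≤ C'(t+1)^{4−3γ} for all t ≥ 0; in particular A(t) − t·A₁ → A₀ as t → ∞. -/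
open Matrix Filter Set

attribute [local instance] Matrix.frobeniusNormedAddCommGroup Matrix.frobeniusNormedSpace

theorem exists_tendsto_and_norm_sub_le_of_norm_deriv_le_rpow {E : Type*} [NormedAddCommGroup E]
    [NormedSpace ℝ E] [CompleteSpace E] {f f' : ℝ → E} {K p : ℝ} (hK : 0 ≤ K) (hp : p < 0)
    (hf : ∀ t ∈ Ici (0 : ℝ), HasDerivWithinAt f (f' t) (Ici 0) t)
    (hf' : ∀ t ∈ Ici (0 : ℝ), ‖f' t‖ ≤ K * (t + 1) ^ (p - 1)) :
    ∃ L : E, Tendsto f atTop (nhds L) ∧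
      ∀ t ∈ Ici (0 : ℝ), ‖f t - L‖ ≤ K / (-p) * (t + 1) ^ p := by
  have key : ∀ s ∈ Ici (0 : ℝ), ∀ t, s ≤ t → ‖f t - f s‖ ≤ K / (-p) * (s + 1) ^ p := by
    intro s hs t hst
    rw [mem_Ici] at hs
    have hB : ∀ x ∈ Icc s t, HasDerivAt
        (fun y : ℝ => K / (-p) * (s + 1) ^ p - K / (-p) * (y + 1) ^ p)
        (K * (x + 1) ^ (p - 1)) x := by
      intro x hx
      have hx1 : x + 1 ≠ 0 := by linarith [hx.1]
      have h := ((((hasDerivAt_id x).add_const 1).rpow_const (p := p) (Or.inl hx1)).const_mul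
        (K / (-p))).const_sub (K / (-p) * (s + 1) ^ p)
      refine h.congr_deriv ?_
      have hp0 : p ≠ 0 := hp.ne
      simp only [id]
      field_simp
    have h := image_norm_le_of_norm_deriv_right_le_deriv_boundary' (f := fun x => f x - f s)
      (f' := f') (a := s) (b := t)
      (fun x hx => (((hf x (hs.trans hx.1)).continuousWithinAt).mono
        (fun y hy => hs.trans hy.1)).sub continuousWithinAt_const)
      (fun x hx => ((hf x (hs.trans hx.1)).mono
        (fun y hy => (hs.trans hx.1).trans hy)).sub_const _)
      (by simp) (fun x hx => (hB x hx).continuousAt.continuousWithinAt)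
      (fun x hx => (hB x (Ico_subset_Icc_self hx)).hasDerivWithinAt)
      (fun x hx => hf' x (hs.trans hx.1)) (right_mem_Icc.2 hst)
    have hpos : 0 ≤ K / (-p) * (t + 1) ^ p :=
      mul_nonneg (div_nonneg hK (by linarith)) (Real.rpow_nonneg (by linarith) _)
    exact h.trans (by linarith)
  have hlim : Tendsto (fun s : ℝ => K / (-p) * (s + 1) ^ p) atTop (nhds 0) := by
    have h := (tendsto_rpow_neg_atTop (y := -p) (by linarith)).comp
      (tendsto_atTop_add_const_right atTop (1 : ℝ) tendsto_id)
    simpa [Function.comp_def] using h.const_mul (K / (-p))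
  have hcauchy : Cauchy (map f atTop) := by
    refine Metric.cauchy_iff.2 ⟨inferInstance, fun ε hε => ?_⟩
    obtain ⟨s, hs, hs0⟩ :=
      ((hlim.eventually_lt_const (half_pos hε)).and (eventually_ge_atTop 0)).exists
    refine ⟨f '' Ici s, image_mem_map (Ici_mem_atTop s), ?_⟩
    rintro _ ⟨x, hx, rfl⟩ _ ⟨y, hy, rfl⟩
    have hxs := key s hs0 x hx
    have hys := key s hs0 y hy
    rw [← dist_eq_norm] at hxs hys
    linarith [dist_triangle_right (f x) (f y) (f s)]
  obtain ⟨L, hL⟩ := CompleteSpace.complete hcauchy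
  refine ⟨L, hL, fun t ht => ?_⟩
  have hL' : Tendsto f atTop (nhds L) := hL
  rw [norm_sub_rev]
  exact le_of_tendsto (hL'.sub_const (f t)).norm
    ((eventually_ge_atTop t).mono fun x hx => key t ht x hx)

theorem sq_frobenius_norm (M : Matrix (Fin 3) (Fin 3) ℝ) : ‖M‖ ^ 2 = ∑ i, ∑ j, M i j ^ 2 := by
  rw [frobenius_norm_def, ← Real.sqrt_eq_rpow, Real.sq_sqrt (by positivity)]
  simp

theorem abs_entry_le_frobenius_norm (M : Matrix (Fin 3) (Fin 3) ℝ) (i j : Fin 3) :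
    |M i j| ≤ ‖M‖ := by
  refine abs_le_of_sq_le_sq ?_ (norm_nonneg _)
  rw [sq_frobenius_norm]
  exact (Finset.single_le_sum (f := fun k => M i k ^ 2) (fun _ _ => sq_nonneg _)
    (Finset.mem_univ j)).trans (Finset.single_le_sum (f := fun l => ∑ k, M l k ^ 2)
      (fun _ _ => Finset.sum_nonneg fun _ _ => sq_nonneg _) (Finset.mem_univ i))

theorem frobenius_norm_le_of_abs_entry_le (M : Matrix (Fin 3) (Fin 3) ℝ) {b : ℝ} (hb : 0 ≤ b)
    (h : ∀ i j, |M i j| ≤ b) : ‖M‖ ≤ 3 * b := by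
  refine le_of_sq_le_sq ?_ (by positivity)
  rw [sq_frobenius_norm]
  calc ∑ i, ∑ j, M i j ^ 2 ≤ ∑ _i : Fin 3, ∑ _j : Fin 3, b ^ 2 :=
        Finset.sum_le_sum fun i _ => Finset.sum_le_sum fun j _ =>
          sq_le_sq.2 ((h i j).trans (le_abs_self b))
    _ = (3 * b) ^ 2 := by simp; ring

theorem frobenius_norm_adjugate_le (M : Matrix (Fin 3) (Fin 3) ℝ) :
    ‖M.adjugate‖ ≤ 6 * ‖M‖ ^ 2 := by
  have hmul : ∀ i j k l, |M i j * M k l| ≤ ‖M‖ ^ 2 := fun i j k l => by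
    rw [abs_mul, sq]
    exact mul_le_mul (abs_entry_le_frobenius_norm M i j) (abs_entry_le_frobenius_norm M k l)
      (abs_nonneg _) (norm_nonneg _)
  have hsub : ∀ x y : ℝ, |x| ≤ ‖M‖ ^ 2 → |y| ≤ ‖M‖ ^ 2 → |x - y| ≤ 2 * ‖M‖ ^ 2 :=
    fun x y hx hy => (abs_sub x y).trans (by linarith)
  have hadd : ∀ x y : ℝ, |x| ≤ ‖M‖ ^ 2 → |y| ≤ ‖M‖ ^ 2 → |-x + y| ≤ 2 * ‖M‖ ^ 2 :=
    fun x y hx hy => by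
      rw [neg_add_eq_sub]
      exact hsub y x hy hx
  refine (frobenius_norm_le_of_abs_entry_le _ (b := 2 * ‖M‖ ^ 2) (by positivity) ?_).trans_eq
    (by ring)
  intro i j
  rw [adjugate_fin_three]
  fin_cases i <;> fin_cases j <;>
    first
      | exact hsub _ _ (hmul _ _ _ _) (hmul _ _ _ _)
      | exact hadd _ _ (hmul _ _ _ _) (hmul _ _ _ _)

theorem norm_rpow_det_smul_inv_transpose_le {γ c C s : ℝ} (hγ : 0 ≤ γ) (hc : 0 < c) (hs : 0 < s)
    {M : Matrix (Fin 3) (Fin 3) ℝ} (hdet : c * s ^ 3 ≤ M.det) (hM : ‖M‖ ≤ C * s) :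
    ‖(M.det ^ (1 - γ)) • (M⁻¹)ᵀ‖ ≤ 6 * C ^ 2 * c ^ (-γ) * s ^ (2 - 3 * γ) := by
  have hcs : 0 < c * s ^ 3 := by positivity
  have hpos : 0 < M.det := hcs.trans_le hdet
  have hcoef : M.det ^ (1 - γ) * (M.det)⁻¹ = M.det ^ (-γ) := by
    rw [← Real.rpow_neg_one M.det, ← Real.rpow_add hpos]
    ring_nf
  have hpow : (c * s ^ 3) ^ (-γ) * s ^ 2 = c ^ (-γ) * s ^ (2 - 3 * γ) := by
    rw [Real.mul_rpow hc.le (by positivity), ← Real.rpow_natCast s 3, ← Real.rpow_mul hs.le,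
      ← Real.rpow_natCast s 2, mul_assoc, ← Real.rpow_add hs]
    push_cast
    ring_nf
  rw [inv_def, Ring.inverse_eq_inv', transpose_smul, smul_smul, hcoef, norm_smul,
    frobenius_norm_transpose, Real.norm_of_nonneg (Real.rpow_nonneg hpos.le _)]
  calc M.det ^ (-γ) * ‖M.adjugate‖ ≤ (c * s ^ 3) ^ (-γ) * (6 * (C * s) ^ 2) := by
        refine mul_le_mul (Real.rpow_le_rpow_of_nonpos hcs hdet (by linarith))
          ((frobenius_norm_adjugate_le M).trans ?_) (norm_nonneg _) (by positivity)
        gcongr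
    _ = 6 * C ^ 2 * ((c * s ^ 3) ^ (-γ) * s ^ 2) := by ring
    _ = 6 * C ^ 2 * c ^ (-γ) * s ^ (2 - 3 * γ) := by rw [hpow]; ring

/-- For `γ > 4/3` and a solution of the affine ODE with the stated growth bounds, there is a unique
matrix `A₀` with `‖A(t) − (t·A₁ + A₀)‖ ≤ C'(t+1)^{4−3γ}`; in particular `A(t) − t·A₁ → A₀`. -/
theorem stmt5 (γ : ℝ) (hγ : 4 / 3 < γ) (c C : ℝ) (hc : 0 < c) (hC : 0 < C)
    (A A' A'' : ℝ → Matrix (Fin 3) (Fin 3) ℝ)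
    (hA : ∀ t ∈ Ici (0 : ℝ), HasDerivWithinAt A (A' t) (Ici 0) t)
    (hA' : ∀ t ∈ Ici (0 : ℝ), HasDerivWithinAt A' (A'' t) (Ici 0) t)
    (hA'' : ContinuousOn A'' (Ici 0))
    (hdet : ∀ t ∈ Ici (0 : ℝ), 0 < (A t).det)
    (hode : ∀ t ∈ Ici (0 : ℝ), A'' t = ((A t).det ^ (1 - γ)) • ((A t)⁻¹)ᵀ)
    (hgrow : ∀ t ∈ Ici (0 : ℝ), c * (t + 1) ^ 3 ≤ (A t).det)
    (hbound : ∀ t ∈ Ici (0 : ℝ), ‖A t‖ ≤ C * (t + 1))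
    (A₁ : Matrix (Fin 3) (Fin 3) ℝ) (hA₁ : Tendsto A' atTop (nhds A₁)) :
    ∃! A₀ : Matrix (Fin 3) (Fin 3) ℝ,
      (∃ C' > (0 : ℝ), ∀ t ∈ Ici (0 : ℝ),
        ‖A t - (t • A₁ + A₀)‖ ≤ C' * (t + 1) ^ (4 - 3 * γ)) ∧
      Tendsto (fun t => A t - t • A₁) atTop (nhds A₀) := by
  set K : ℝ := 6 * C ^ 2 * c ^ (-γ) with hKdef
  have hK : 0 < K := by positivity
  obtain ⟨L, hL, hLb⟩ := exists_tendsto_and_norm_sub_le_of_norm_deriv_le_rpow (K := K)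
    (p := 3 - 3 * γ) hK.le (by linarith) hA' (fun t ht => by
      have ht' : (0 : ℝ) < t + 1 := by linarith [mem_Ici.1 ht]
      rw [hode t ht, show 3 - 3 * γ - 1 = 2 - 3 * γ by ring]
      exact norm_rpow_det_smul_inv_transpose_le (by linarith) hc ht' (hgrow t ht) (hbound t ht))
  obtain rfl := tendsto_nhds_unique hA₁ hL
  have hK' : 0 < K / -(3 - 3 * γ) := div_pos hK (by linarith)
  obtain ⟨A₀, hA₀, hA₀b⟩ := exists_tendsto_and_norm_sub_le_of_norm_deriv_le_rpow
    (f := fun t => A t - t • A₁) (f' := fun t => A' t - A₁) (p := 4 - 3 * γ) hK'.le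
    (by linarith)
    (fun t ht => by
      exact ((hA t ht).fun_sub ((hasDerivWithinAt_id t (Ici 0)).smul_const A₁)).congr_deriv
        (by rw [one_smul]))
    (fun t ht => by
      rw [show 4 - 3 * γ - 1 = 3 - 3 * γ by ring]
      exact hLb t ht)
  refine ⟨A₀, ⟨⟨_, div_pos hK' (by linarith : 0 < -(4 - 3 * γ)), fun t ht => ?_⟩, hA₀⟩,
    fun B hB => tendsto_nhds_unique hB.2 hA₀⟩
  rw [← sub_sub]
  exact hA₀b t ht
end

section
/- Let k > 1 be a real number and let α : [0,∞) → ℝ be twice continuously differentiable with α(t) > 0 for all t ≥ 0, α''(t) = α(t)^{−k} for all t ≥ 0, α(0) = 1, and α'(0) ≥ 0. Then: (i) α' is nonnegative and nondecreasing, and α(t) ≥ 1 for all t ≥ 0; (ii) α'(t) converges as t → ∞ to a limit L with 0 < L ≤ √(α'(0)² + 2/(k−1)); (iii) there exist constants 0 < c₁ ≤ c₂ such that c₁(1+t) ≤ α(t) ≤ c₂(1+t) for all t ≥ 0; and (iv) for every δ > 0, ∫₀^∞ α(s)^{−(1+δ)} ds < ∞. -/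
open Filter Set MeasureTheory

theorem monotoneOn_Ici_of_hasDerivWithinAt_nonneg {f f' : ℝ → ℝ} {a : ℝ}
    (hf : ∀ t ∈ Ici a, HasDerivWithinAt f (f' t) (Ici a) t) (hf' : ∀ t ∈ Ici a, 0 ≤ f' t) :
    MonotoneOn f (Ici a) :=
  monotoneOn_of_hasDerivWithinAt_nonneg (convex_Ici a)
    (fun t ht => (hf t ht).continuousWithinAt)
    (fun t ht => (hf t (interior_subset ht)).mono interior_subset)
    (fun t ht => hf' t (interior_subset ht))

theorem MonotoneOn.exists_tendsto_atTop {f : ℝ → ℝ} {a S : ℝ} (hf : MonotoneOn f (Ici a))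
    (hS : ∀ t ∈ Ici a, f t ≤ S) :
    ∃ L, Tendsto f atTop (nhds L) ∧ L ≤ S ∧ ∀ t ∈ Ici a, f t ≤ L := by
  have hmono : Monotone fun t => f (max t a) := fun x y hxy =>
    hf (le_max_right x a) (le_max_right y a) (max_le_max_right a hxy)
  have hbdd : BddAbove (range fun t => f (max t a)) :=
    ⟨S, by rintro _ ⟨t, rfl⟩; exact hS _ (le_max_right t a)⟩
  refine ⟨_, (tendsto_atTop_ciSup hmono hbdd).congr' ?_,
    ciSup_le fun t => hS _ (le_max_right t a), fun t ht => ?_⟩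
  · filter_upwards [eventually_ge_atTop a] with t ht
    rw [max_eq_left ht]
  · simpa [max_eq_left (mem_Ici.1 ht)] using le_ciSup hbdd t

theorem integrableOn_rpow_neg_of_linear_le {f : ℝ → ℝ} {c p : ℝ} (hc : 0 < c) (hp : 1 < p)
    (hf : ContinuousOn f (Ici 0)) (hle : ∀ t ∈ Ici (0 : ℝ), c * (1 + t) ≤ f t) :
    IntegrableOn (fun s => f s ^ (-p)) (Ici 0) volume := by
  have hbound : IntegrableOn (fun s : ℝ => c ^ (-p) * (s + 1) ^ (-p)) (Ici 0) volume := by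
    rw [integrableOn_Ici_iff_integrableOn_Ioi]
    exact (integrableOn_add_rpow_Ioi_of_lt (by linarith) (by norm_num)).const_mul _
  have hpos : ∀ t ∈ Ici (0 : ℝ), 0 < c * (1 + t) := fun t ht =>
    mul_pos hc (by linarith [mem_Ici.1 ht])
  refine Integrable.mono' hbound
    ((hf.rpow_const fun t ht =>
      Or.inl ((hpos t ht).trans_le (hle t ht)).ne').aestronglyMeasurable measurableSet_Ici) ?_
  filter_upwards [ae_restrict_mem measurableSet_Ici] with t ht
  have ht0 : (0 : ℝ) ≤ t := ht
  rw [Real.norm_of_nonneg (Real.rpow_nonneg ((hpos t ht).le.trans (hle t ht)) _),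
    ← Real.mul_rpow hc.le (by linarith), add_comm t 1]
  exact Real.rpow_le_rpow_of_nonpos (hpos t ht) (hle t ht) (by linarith)

/-- Properties of the scalar affine ODE `α'' = α^{−k}`, `k > 1`, with `α(0) = 1`, `α'(0) ≥ 0`:
(i) `α'` is nonnegative and nondecreasing and `α ≥ 1`; (ii) `α'` converges to a positive limit
`L ≤ √(α'(0)² + 2/(k−1))`; (iii) `α(t)` grows linearly; (iv) `α^{−(1+δ)}` is integrable on
`[0,∞)` for every `δ > 0`. -/
theorem stmt6 (k : ℝ) (hk : 1 < k) (α α' α'' : ℝ → ℝ)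
    (hpos : ∀ t ∈ Ici (0 : ℝ), 0 < α t)
    (hα : ∀ t ∈ Ici (0 : ℝ), HasDerivWithinAt α (α' t) (Ici 0) t)
    (hα' : ∀ t ∈ Ici (0 : ℝ), HasDerivWithinAt α' (α'' t) (Ici 0) t)
    (hα'' : ContinuousOn α'' (Ici 0))
    (hode : ∀ t ∈ Ici (0 : ℝ), α'' t = α t ^ (-k))
    (h0 : α 0 = 1) (h0' : 0 ≤ α' 0) :
    ((∀ t ∈ Ici (0 : ℝ), 0 ≤ α' t) ∧ MonotoneOn α' (Ici 0) ∧ ∀ t ∈ Ici (0 : ℝ), 1 ≤ α t) ∧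
    (∃ L : ℝ, Tendsto α' atTop (nhds L) ∧ 0 < L ∧
      L ≤ Real.sqrt (α' 0 ^ 2 + 2 / (k - 1))) ∧
    (∃ c₁ c₂ : ℝ, 0 < c₁ ∧ c₁ ≤ c₂ ∧
      ∀ t ∈ Ici (0 : ℝ), c₁ * (1 + t) ≤ α t ∧ α t ≤ c₂ * (1 + t)) ∧
    (∀ δ > (0 : ℝ), IntegrableOn (fun s => α s ^ (-(1 + δ))) (Ici 0) volume) := by
  have hsecond : ∀ t ∈ Ici (0 : ℝ), 0 < α'' t := fun t ht => by
    rw [hode t ht]; exact Real.rpow_pos_of_pos (hpos t ht) _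
  have hmono : MonotoneOn α' (Ici 0) :=
    monotoneOn_Ici_of_hasDerivWithinAt_nonneg hα' fun t ht => (hsecond t ht).le
  have hnonneg : ∀ t ∈ Ici (0 : ℝ), 0 ≤ α' t := fun t ht =>
    h0'.trans (hmono self_mem_Ici ht ht)
  have hαmono : MonotoneOn α (Ici 0) := monotoneOn_Ici_of_hasDerivWithinAt_nonneg hα hnonneg
  have hone : ∀ t ∈ Ici (0 : ℝ), 1 ≤ α t := fun t ht => h0 ▸ hαmono self_mem_Ici ht ht
  have hk' : k - 1 ≠ 0 := by linarith
  have henergy : MonotoneOn (fun t => -(α' t ^ 2 + 2 / (k - 1) * α t ^ (1 - k))) (Ici 0) := by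
    refine monotoneOn_Ici_of_hasDerivWithinAt_nonneg (f' := fun _ => 0) (fun t ht => ?_)
      fun _ _ => le_rfl
    refine (((hα' t ht).fun_pow 2).fun_add (((hα t ht).rpow_const (p := 1 - k)
      (Or.inl (hpos t ht).ne')).const_mul (2 / (k - 1)))).fun_neg.congr_deriv ?_
    rw [hode t ht, show 1 - k - 1 = -k by ring]
    field_simp
    ring
  set S := Real.sqrt (α' 0 ^ 2 + 2 / (k - 1)) with hS
  have hle : ∀ t ∈ Ici (0 : ℝ), α' t ≤ S := fun t ht => by
    refine Real.le_sqrt_of_sq_le ?_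
    have h1 := henergy self_mem_Ici ht ht
    have h2 : 0 ≤ 2 / (k - 1) * α t ^ (1 - k) :=
      mul_nonneg (div_nonneg zero_le_two (by linarith)) (Real.rpow_nonneg (hpos t ht).le _)
    simp only [h0, Real.one_rpow] at h1
    linarith
  have hm : 0 < α' 1 := by
    have hstrict : StrictMonoOn α' (Ici 0) :=
      strictMonoOn_of_hasDerivWithinAt_pos (convex_Ici 0)
        (fun t ht => (hα' t ht).continuousWithinAt)
        (fun t ht => (hα' t (interior_subset ht)).mono interior_subset)
        (fun t ht => hsecond t (interior_subset ht))
    exact h0'.trans_lt (hstrict self_mem_Ici (mem_Ici.2 zero_le_one) one_pos)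
  obtain ⟨L, hL, hLS, hαL⟩ := hmono.exists_tendsto_atTop hle
  have hsub : Ici (1 : ℝ) ⊆ Ici 0 := Ici_subset_Ici.2 zero_le_one
  have hlower : MonotoneOn (fun t => α t - α' 1 * t) (Ici 1) :=
    monotoneOn_Ici_of_hasDerivWithinAt_nonneg (f' := fun t => α' t - α' 1)
      (fun t ht => by
        simpa using ((hα t (hsub ht)).mono hsub).fun_sub
          ((hasDerivWithinAt_id t (Ici 1)).const_mul (α' 1)))
      (fun t ht => sub_nonneg.2 (hmono (hsub self_mem_Ici) (hsub ht) ht))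
  have hupper : MonotoneOn (fun t => S * t - α t) (Ici 0) :=
    monotoneOn_Ici_of_hasDerivWithinAt_nonneg (f' := fun t => S - α' t)
      (fun t ht => by
        simpa using ((hasDerivWithinAt_id t (Ici 0)).const_mul S).fun_sub (hα t ht))
      (fun t ht => sub_nonneg.2 (hle t ht))
  have hS0 : 0 ≤ S := Real.sqrt_nonneg _
  have hc0 : 0 < min (1 / 2) (α' 1) := lt_min one_half_pos hm
  have hc1 : min (1 / 2) (α' 1) ≤ 1 / 2 := min_le_left _ _
  have hc2 : min (1 / 2) (α' 1) ≤ α' 1 := min_le_right _ _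
  have hlin : ∀ t ∈ Ici (0 : ℝ), min (1 / 2) (α' 1) * (1 + t) ≤ α t := fun t ht => by
    rcases le_total t 1 with h | h
    · have := hone t ht
      nlinarith
    · have h1 : α 1 - α' 1 * 1 ≤ α t - α' 1 * t := hlower self_mem_Ici h h
      have h2 := hone 1 (mem_Ici.2 zero_le_one)
      nlinarith
  refine ⟨⟨hnonneg, hmono, hone⟩, ⟨L, hL, hm.trans_le (hαL 1 (mem_Ici.2 zero_le_one)), hLS⟩,
    ⟨_, 1 + S, hc0, by linarith, fun t ht => ⟨hlin t ht, ?_⟩⟩, fun δ hδ => ?_⟩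
  · have h1 : S * 0 - α 0 ≤ S * t - α t := hupper self_mem_Ici ht ht
    have ht0 : (0 : ℝ) ≤ t := ht
    nlinarith
  · exact integrableOn_rpow_neg_of_linear_le hc0 (by linarith)
      (fun t ht => (hα t ht).continuousWithinAt) hlin
end

section
/- Let B = {x ∈ ℝ³ : |x| < 1} be the open unit ball and d(x) = (1/4)(1 − |x|²). Let w : B → ℝ be twice continuously differentiable and let ℓ ≥ 2 be an integer. Then for all indices i, m ∈ {1,2,3} and all x ∈ B, the identity −∂_m( d^{1−ℓ} ∂_i( d^ℓ w ) )(x) = −d(x)^{−ℓ} ∂_i( d^{ℓ+1} ∂_m w )(x) + (ℓ/2) δ_{im} w(x) + ∂_i d(x) ∂_m w(x) − ∂_m d(x) ∂_i w(x) holds, where δ_{im} is the Kronecker delta. -/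
open Set

noncomputable section

/-- Partial derivative `∂_i f` of a scalar function on `ℝ³` (realized as `Fin 3 → ℝ`). -/
def pd (i : Fin 3) (f : (Fin 3 → ℝ) → ℝ) (x : Fin 3 → ℝ) : ℝ :=
  fderiv ℝ f x (Pi.single i 1)

/-- The open unit ball `B = {x ∈ ℝ³ : |x| < 1}` (Euclidean norm). -/
def ball3 : Set (Fin 3 → ℝ) := {x | ∑ i, x i ^ 2 < 1}

/-- The weight function `d(x) = (1/4)(1 − |x|²)`. -/
def dw (x : Fin 3 → ℝ) : ℝ := (1 - ∑ i, x i ^ 2) / 4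

theorem pd_congr {f g : (Fin 3 → ℝ) → ℝ} {x : Fin 3 → ℝ} (h : f =ᶠ[nhds x] g) (i : Fin 3) :
    pd i f x = pd i g x := by
  simp only [pd, h.fderiv_eq]

theorem pd_mul {f g : (Fin 3 → ℝ) → ℝ} {x : Fin 3 → ℝ} (hf : DifferentiableAt ℝ f x)
    (hg : DifferentiableAt ℝ g x) (i : Fin 3) :
    pd i (fun y => f y * g y) x = f x * pd i g x + g x * pd i f x := by
  simp only [pd, fderiv_fun_mul hf hg]
  simp

theorem pd_add {f g : (Fin 3 → ℝ) → ℝ} {x : Fin 3 → ℝ} (hf : DifferentiableAt ℝ f x)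
    (hg : DifferentiableAt ℝ g x) (i : Fin 3) :
    pd i (fun y => f y + g y) x = pd i f x + pd i g x := by
  simp only [pd, fderiv_fun_add hf hg]
  simp

theorem pd_const_mul_apply (c : ℝ) (i m : Fin 3) (x : Fin 3 → ℝ) :
    pd m (fun y => c * y i) x = c * if i = m then 1 else 0 := by
  have h : HasFDerivAt (fun y : Fin 3 → ℝ => c * y i)
      (c • ContinuousLinearMap.proj (R := ℝ) (φ := fun _ : Fin 3 => ℝ) i) x :=
    (hasFDerivAt_apply i x).const_mul c
  simp [pd, h.fderiv, Pi.single_apply]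

theorem differentiable_dw : Differentiable ℝ dw := by
  unfold dw
  fun_prop

theorem pd_dw (i : Fin 3) (x : Fin 3 → ℝ) : pd i dw x = -(1 / 2) * x i := by
  have h : HasFDerivAt dw ((4 : ℝ)⁻¹ • -(∑ j : Fin 3, (2 * x j) •
      ContinuousLinearMap.proj (R := ℝ) (φ := fun _ : Fin 3 => ℝ) j)) x := by
    have hs : HasFDerivAt (fun y : Fin 3 → ℝ => ∑ j, y j ^ 2) (∑ j : Fin 3, (2 * x j) •
        ContinuousLinearMap.proj (R := ℝ) (φ := fun _ : Fin 3 => ℝ) j) x := by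
      refine HasFDerivAt.fun_sum fun j _ => ?_
      simpa using (hasFDerivAt_apply (𝕜 := ℝ) j x).pow 2
    have hdw : dw = fun y => (4 : ℝ)⁻¹ * (1 - ∑ j, y j ^ 2) := funext fun y => div_eq_inv_mul _ _
    rw [hdw]
    exact (hs.const_sub 1).const_mul (4 : ℝ)⁻¹
  simp only [pd, h.fderiv]
  simp [Pi.single_apply]
  ring

theorem dw_pos {x : Fin 3 → ℝ} (hx : x ∈ ball3) : 0 < dw x := by
  have : ∑ i, x i ^ 2 < 1 := hx
  unfold dw
  linarith

theorem isOpen_ball3 : IsOpen ball3 :=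
  isOpen_lt (by fun_prop) continuous_const

theorem hasFDerivAt_dw_zpow {x : Fin 3 → ℝ} (hx : x ∈ ball3) (n : ℤ) :
    HasFDerivAt (fun y => dw y ^ n) ((n * dw x ^ (n - 1)) • fderiv ℝ dw x) x :=
  (hasDerivAt_zpow n (dw x) (Or.inl (dw_pos hx).ne')).comp_hasFDerivAt x
    (differentiable_dw x).hasFDerivAt

theorem pd_dw_zpow_mul {x : Fin 3 → ℝ} (hx : x ∈ ball3) (n : ℤ) {f : (Fin 3 → ℝ) → ℝ}
    (hf : DifferentiableAt ℝ f x) (i : Fin 3) :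
    pd i (fun y => dw y ^ n * f y) x
      = dw x ^ (n - 1) * (n * (pd i dw x * f x) + dw x * pd i f x) := by
  have h := hasFDerivAt_dw_zpow hx n
  rw [pd_mul h.differentiableAt hf]
  have hd : dw x ^ n = dw x ^ (n - 1) * dw x := by
    rw [← zpow_add_one₀ (dw_pos hx).ne', sub_add_cancel]
  simp only [pd, h.fderiv, hd]
  simp
  ring

theorem differentiableAt_pd {f : (Fin 3 → ℝ) → ℝ} {x : Fin 3 → ℝ} (hf : ContDiffAt ℝ 2 f x)
    (i : Fin 3) : DifferentiableAt ℝ (pd i f) x := by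
  have h : DifferentiableAt ℝ (fderiv ℝ f) x :=
    (hf.fderiv_right (m := 1) (by norm_num)).differentiableAt (by norm_num)
  exact h.clm_apply (differentiableAt_const _)

theorem pd_comm {f : (Fin 3 → ℝ) → ℝ} {x : Fin 3 → ℝ} (hf : ContDiffAt ℝ 2 f x)
    (i m : Fin 3) : pd i (pd m f) x = pd m (pd i f) x := by
  have h : DifferentiableAt ℝ (fderiv ℝ f) x :=
    (hf.fderiv_right (m := 1) (by norm_num)).differentiableAt (by norm_num)
  have key (j k : Fin 3) : pd j (pd k f) x =
      fderiv ℝ (fderiv ℝ f) x (Pi.single j 1) (Pi.single k 1) := by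
    change fderiv ℝ (fun y => fderiv ℝ f y (Pi.single k 1)) x (Pi.single j 1) = _
    rw [fderiv_clm_apply h (differentiableAt_const _)]
    simp
  rw [key, key]
  exact (hf.isSymmSndFDerivAt (by simp)).eq _ _

/-- The commutation identity of Lemma `cor1` (base case): for `ℓ ≥ 2` and `w ∈ C²(B)`,
`−∂_m(d^{1−ℓ} ∂_i(d^ℓ w)) = −d^{−ℓ} ∂_i(d^{ℓ+1} ∂_m w) + (ℓ/2)δ_{im} w + ∂_i d ∂_m w − ∂_m d ∂_i w`
on the open unit ball. -/
theorem stmt7 (w : (Fin 3 → ℝ) → ℝ) (hw : ContDiffOn ℝ 2 w ball3)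
    (ℓ : ℕ) (hℓ : 2 ≤ ℓ) :
    ∀ i m : Fin 3, ∀ x ∈ ball3,
      -(pd m (fun y => dw y ^ (1 - (ℓ : ℤ)) * pd i (fun z => dw z ^ (ℓ : ℤ) * w z) y) x)
        = -(dw x ^ (-(ℓ : ℤ))) * pd i (fun y => dw y ^ ((ℓ : ℤ) + 1) * pd m w y) x
          + ((ℓ : ℝ) / 2) * (if i = m then (1 : ℝ) else 0) * w x
          + pd i dw x * pd m w x - pd m dw x * pd i w x := by
  intro i m x hx
  have hC : ∀ y ∈ ball3, ContDiffAt ℝ 2 w y := fun y hy =>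
    hw.contDiffAt (isOpen_ball3.mem_nhds hy)
  have hD : ∀ y ∈ ball3, DifferentiableAt ℝ w y := fun y hy =>
    (hC y hy).differentiableAt (by norm_num)
  have hinner : (fun y => dw y ^ (1 - (ℓ : ℤ)) * pd i (fun z => dw z ^ (ℓ : ℤ) * w z) y)
      =ᶠ[nhds x] fun y => (-(ℓ / 2 : ℝ) * y i) * w y + dw y * pd i w y := by
    filter_upwards [isOpen_ball3.mem_nhds hx] with y hy
    rw [pd_dw_zpow_mul hy _ (hD y hy), ← mul_assoc, ← zpow_add₀ (dw_pos hy).ne', pd_dw]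
    simp only [sub_add_sub_cancel, sub_self, zpow_zero, Int.cast_natCast]
    ring
  have hl : DifferentiableAt ℝ (fun y : Fin 3 → ℝ => -(ℓ / 2 : ℝ) * y i) x := by fun_prop
  have hpd := differentiableAt_pd (hC x hx)
  rw [pd_congr hinner, pd_add (hl.fun_mul (hD x hx)) ((differentiable_dw x).fun_mul (hpd i)),
    pd_mul hl (hD x hx), pd_mul (differentiable_dw x) (hpd i), pd_const_mul_apply,
    pd_dw_zpow_mul hx _ (hpd m), pd_comm (hC x hx) i m, ← mul_assoc (-(dw x ^ _)), neg_mul (dw x ^ _),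
    ← zpow_add₀ (dw_pos hx).ne', pd_dw, pd_dw]
  simp only [add_sub_cancel_right, neg_add_cancel, zpow_zero]
  push_cast
  ring
end
end
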